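/- There exists a positive constant c3 such that for every connected d-regular Eulerian digraph G on n vertices and every a>0, the lazy simple random walk on G satisfies t_unif(a) ≤ c3·n²/a². -/

import Mathlib

open Finset

/-- The out-degree of a vertex in a digraph. -/
def dout {V : Type} [Fintype V] (E : V → V → Prop) [DecidableRel E] (x : V) : ℕ :=
  (Finset.univ.filter fun y => E x y).card

/-- The in-degree of a vertex in a digraph. -/
def din {V : Type} [Fintype V] (E : V → V → Prop) [DecidableRel E] (x : V) : ℕ :=
  (Finset.univ.filter fun y => E y x).card

/-- The number of directed edges of a digraph. -/
def numEdges {V : Type} [Fintype V] (E : V → V → Prop) [DecidableRel E] : ℕ :=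
  ∑ x, dout E x

/-- The transition matrix of the lazy simple random walk on a digraph. -/
noncomputable def lazyP {V : Type} [Fintype V] [DecidableEq V] (E : V → V → Prop)
    [DecidableRel E] : Matrix V V ℝ :=
  fun v w => if v = w then 1 / 2 else if E v w then 1 / (2 * (dout E v : ℝ)) else 0

/-- The stationary distribution `π(v) = d_out(v)/m` of the lazy walk on an Eulerian digraph. -/
noncomputable def statDist {V : Type} [Fintype V] (E : V → V → Prop) [DecidableRel E]
    (v : V) : ℝ :=
  (dout E v : ℝ) / (numEdges E : ℝ)

/-- The sum of squared increments of `g` along the edges of a digraph. -/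
def edgeEnergy {V : Type} [Fintype V] (E : V → V → Prop) [DecidableRel E] (g : V → ℝ) : ℝ :=
  ∑ x, ∑ y, if E x y then (g x - g y) ^ 2 else 0

/-- In a connected digraph, a shortest path from `x` to a set avoids the set before its end, and
its vertices are at consecutive distances from `x`. -/
lemma exists_geodesic_to_set {V : Type} [Fintype V] (E : V → V → Prop)
    (hconn : (SimpleGraph.fromRel E).Connected) (x : V) (s : Set V) (hs : s.Nonempty) :
    ∃ (L : ℕ) (v : ℕ → V), v 0 = x ∧ v L ∈ s ∧ (∀ i < L, v i ∉ s) ∧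
      (∀ i < L, E (v i) (v (i + 1)) ∨ E (v (i + 1)) (v i)) ∧
      ∀ i ≤ L, (SimpleGraph.fromRel E).dist x (v i) = i := by
  classical
  set G := SimpleGraph.fromRel E
  obtain ⟨y, hy, hmin⟩ := exists_min_image (univ.filter (· ∈ s)) (G.dist x)
    (by obtain ⟨z, hz⟩ := hs; exact ⟨z, by simpa using hz⟩)
  simp only [mem_filter, mem_univ, true_and] at hy hmin
  obtain ⟨p, hp⟩ := hconn.exists_walk_length_eq_dist x y
  have hle : ∀ i, G.dist x (p.getVert i) ≤ i := fun i =>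
    (SimpleGraph.dist_le (p.take i)).trans (by simp)
  refine ⟨p.length, p.getVert, by simp, by simpa using hy, fun i hi hmem => ?_, fun i hi => ?_,
    fun i hi => ?_⟩
  · have := hmin _ hmem
    have := hle i
    omega
  · exact ((SimpleGraph.fromRel_adj E _ _).1 (p.adj_getVert_succ hi)).2
  · have h1 : G.dist (p.getVert i) y ≤ p.length - i :=
      (SimpleGraph.dist_le (p.drop i)).trans (by simp)
    have h2 := hconn.dist_triangle (u := x) (v := p.getVert i) (w := y)
    have h3 := hle i
    omega

section Nash

variable {V : Type} [Fintype V] (E : V → V → Prop) [DecidableRel E]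

lemma edgeEnergy_neg (g : V → ℝ) : edgeEnergy E (-g) = edgeEnergy E g := by
  unfold edgeEnergy
  refine sum_congr rfl fun x _ => sum_congr rfl fun y _ => ?_
  simp only [Pi.neg_apply]
  split_ifs <;> ring

lemma sum_out_nonneg (g : V → ℝ) (x : V) :
    0 ≤ ∑ y, if E x y then (g x - g y) ^ 2 else 0 :=
  sum_nonneg fun y _ => by split_ifs <;> positivity

lemma edgeEnergy_nonneg (g : V → ℝ) : 0 ≤ edgeEnergy E g :=
  sum_nonneg fun x _ => sum_out_nonneg E g x

lemma sum_out_const (x : V) (c : ℝ) : (∑ y, if E x y then c else 0) = dout E x * c := by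
  rw [← sum_filter, sum_const, nsmul_eq_mul, dout]

lemma sum_in_const (x : V) (c : ℝ) : (∑ y, if E y x then c else 0) = din E x * c := by
  rw [← sum_filter, sum_const, nsmul_eq_mul, din]

/-- Around a vertex where `g` is at least `M / 2`, either the increments of `g` along the outgoing
edges or the values of `g` at the out-neighbours are large. -/
lemma local_energy_add_mass (g : V → ℝ) (M : ℝ) (v : V) (hM : 0 < M) (hv : M / 2 ≤ g v) :
    dout E v * (M ^ 2 / 4) ≤
      (∑ y, if E v y then (g v - g y) ^ 2 else 0) + M * ∑ y, if E v y then |g y| else 0 := by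
  rw [← sum_out_const, mul_sum, ← sum_add_distrib]
  refine sum_le_sum fun y _ => ?_
  split_ifs
  · rcases le_total 0 (g y) with h | h
    · rw [abs_of_nonneg h]
      nlinarith [sq_nonneg (g y - (g v - M / 2))]
    · have : 0 ≤ M * |g y| := by positivity
      nlinarith
  · simp

/-- The squared increments of `g` along an undirected path sum to at most twice the edge energy. -/
lemma sum_path_increments_le (g : V → ℝ) (v : ℕ → V) (L : ℕ)
    (hinj : Set.InjOn v (range L : Set ℕ))
    (hadj : ∀ i < L, E (v i) (v (i + 1)) ∨ E (v (i + 1)) (v i)) :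
    ∑ i ∈ range L, (g (v i) - g (v (i + 1))) ^ 2 ≤ 2 * edgeEnergy E g := by
  classical
  let F : V → V → ℝ := fun x y =>
    (if E x y then (g x - g y) ^ 2 else 0) + if E y x then (g y - g x) ^ 2 else 0
  have hF : ∀ x y, 0 ≤ F x y := fun x y => by
    simp only [F]; split_ifs <;> positivity
  have htotal : ∑ x, ∑ y, F x y = 2 * edgeEnergy E g := by
    simp only [F, sum_add_distrib]
    rw [sum_comm (f := fun x y => if E y x then (g y - g x) ^ 2 else 0)]
    simp only [edgeEnergy]; ring
  rw [← htotal]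
  calc ∑ i ∈ range L, (g (v i) - g (v (i + 1))) ^ 2
      ≤ ∑ i ∈ range L, ∑ y, F (v i) y := by
        refine sum_le_sum fun i hi => ?_
        refine le_trans ?_ (single_le_sum (fun y _ => hF (v i) y) (mem_univ (v (i + 1))))
        simp only [F]
        have h1 := sq_nonneg (g (v i) - g (v (i + 1)))
        have h2 : (g (v (i + 1)) - g (v i)) ^ 2 = (g (v i) - g (v (i + 1))) ^ 2 := by ring
        rw [h2]
        rcases hadj i (mem_range.1 hi) with h | h <;> rw [if_pos h] <;> split_ifs <;> linarith
    _ = ∑ x ∈ (range L).image v, ∑ y, F x y :=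
        (sum_image (f := fun x => ∑ y, F x y) fun i hi j hj h => hinj hi hj h).symm
    _ ≤ ∑ x, ∑ y, F x y :=
        sum_le_sum_of_subset_of_nonneg (subset_univ _) fun x _ _ => sum_nonneg fun y _ => hF x y

/-- The one-dimensional Nash-type inequality on a connected regular digraph, at a positive value. -/
lemma nash_of_pos {d : ℕ} (hd : 0 < d) (hdeg : ∀ x, dout E x = d)
    (hconn : (SimpleGraph.fromRel E).Connected) (g : V → ℝ) (x : V) (hx : 0 < g x)
    (hneg : ∃ y, g y ≤ 0) :
    d * g x ^ 3 ≤ 192 * (∑ y, |g y|) * edgeEnergy E g := by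
  set M := g x with hMdef
  set N := ∑ y, |g y| with hN
  have hMN : M ≤ N := (le_abs_self _).trans
    (single_le_sum (f := fun y => |g y|) (fun y _ => abs_nonneg _) (mem_univ x))
  have hd' : (0 : ℝ) < d := by exact_mod_cast hd
  obtain ⟨L, v, hv0, hvL, hvlt, hadj, hdist⟩ := exists_geodesic_to_set E hconn x {y | g y < M / 2}
    (by obtain ⟨y, hy⟩ := hneg; exact ⟨y, by simp only [Set.mem_ofPred_eq]; linarith⟩)
  simp only [Set.mem_ofPred_eq, not_lt] at hvL hvlt
  by_cases hA : ∃ i < L, (d : ℝ) * M ^ 2 / 8 ≤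
      ∑ y, if E (v i) y then (g (v i) - g y) ^ 2 else 0
  · obtain ⟨i, -, hi⟩ := hA
    have hS : (d : ℝ) * M ^ 2 / 8 ≤ edgeEnergy E g :=
      hi.trans (single_le_sum (f := fun x => ∑ y, if E x y then (g x - g y) ^ 2 else 0)
        (fun x _ => sum_out_nonneg E g x) (mem_univ (v i)))
    have h1 : M * (d * M ^ 2 / 8) ≤ N * edgeEnergy E g :=
      mul_le_mul hMN hS (by positivity) (hx.le.trans hMN)
    have h2 : 0 ≤ N * edgeEnergy E g := mul_nonneg (hx.le.trans hMN) (edgeEnergy_nonneg E g)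
    nlinarith
  · push Not at hA
    have hmass : ∀ i ∈ range L, (d : ℝ) * M / 8 ≤ ∑ y, if E (v i) y then |g y| else 0 := by
      intro i hi
      have hi' := mem_range.1 hi
      have h1 := local_energy_add_mass E g M (v i) hx (hvlt i hi')
      rw [hdeg] at h1
      have h2 := hA i hi'
      by_contra hcon
      push Not at hcon
      nlinarith [mul_lt_mul_of_pos_left hcon hx]
    have hcount : ∀ w, ∑ i ∈ range L, (if E (v i) w then |g w| else 0) ≤ 3 * |g w| := by
      intro w
      rw [← sum_filter, sum_const, nsmul_eq_mul]
      refine mul_le_mul_of_nonneg_right ?_ (abs_nonneg _)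
      have hsub : (range L).filter (fun i => E (v i) w) ⊆
          Icc ((SimpleGraph.fromRel E).dist x w - 1) ((SimpleGraph.fromRel E).dist x w + 1) := by
        intro i hi
        obtain ⟨hiL, hiE⟩ := mem_filter.1 hi
        have hi1 := hdist i (mem_range.1 hiL).le
        have hstep : (SimpleGraph.fromRel E).dist (v i) w ≤ 1 := by
          by_cases hne : v i = w
          · simp [hne]
          · exact (SimpleGraph.dist_eq_one_iff_adj.2
              ((SimpleGraph.fromRel_adj E _ _).2 ⟨hne, Or.inl hiE⟩)).le
        have t1 := hconn.dist_triangle (u := x) (v := v i) (w := w)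
        have t2 := hconn.dist_triangle (u := x) (v := w) (w := v i)
        rw [SimpleGraph.dist_comm (u := w)] at t2
        rw [mem_Icc]; omega
      have hcard := card_le_card hsub
      rw [Nat.card_Icc] at hcard
      exact_mod_cast hcard.trans (by omega)
    have hL : (L : ℝ) * (d * M / 8) ≤ 3 * N := by
      calc (L : ℝ) * (d * M / 8) = ∑ i ∈ range L, (d : ℝ) * M / 8 := by simp
        _ ≤ ∑ i ∈ range L, ∑ w, if E (v i) w then |g w| else 0 := sum_le_sum hmass
        _ = ∑ w, ∑ i ∈ range L, if E (v i) w then |g w| else 0 := sum_comm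
        _ ≤ ∑ w, 3 * |g w| := sum_le_sum fun w _ => hcount w
        _ = 3 * N := by rw [hN, mul_sum]
    have hpath := sum_path_increments_le E g v L (fun i hi j hj h => by
      have h1 := hdist i (mem_range.1 hi).le
      have h2 := hdist j (mem_range.1 hj).le
      rw [← h1, h, h2]) hadj
    have hcs := sq_sum_le_card_mul_sum_sq (s := range L) (f := fun i => g (v i) - g (v (i + 1)))
    rw [sum_range_sub', card_range, hv0] at hcs
    have hdrop : (M / 2) ^ 2 ≤ (g x - g (v L)) ^ 2 :=
      pow_le_pow_left₀ (by positivity) (by linarith) 2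
    have h1 : M ^ 2 / 4 ≤ L * (2 * edgeEnergy E g) := by
      have := mul_le_mul_of_nonneg_left hpath (Nat.cast_nonneg L : (0 : ℝ) ≤ L)
      linarith
    have h2 := mul_le_mul_of_nonneg_right hL (edgeEnergy_nonneg E g)
    have h3 := mul_le_mul_of_nonneg_left h1 (by positivity : 0 ≤ (d : ℝ) * M)
    nlinarith

lemma exists_nonpos_of_sum_eq_zero [Nonempty V] (g : V → ℝ) (h : ∑ x, g x = 0) :
    ∃ y, g y ≤ 0 := by
  obtain ⟨y, -, hy⟩ := exists_le_of_sum_le (s := univ) (f := g) (g := fun _ => 0)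
    univ_nonempty (by simp [h])
  exact ⟨y, hy⟩

lemma nash_abs {d : ℕ} (hd : 0 < d) (hdeg : ∀ x, dout E x = d)
    (hconn : (SimpleGraph.fromRel E).Connected) (g : V → ℝ) (hg : ∑ x, g x = 0) (x : V) :
    d * |g x| ^ 3 ≤ 192 * (∑ y, |g y|) * edgeEnergy E g := by
  have : Nonempty V := ⟨x⟩
  rcases lt_trichotomy (g x) 0 with h | h | h
  · have := nash_of_pos E hd hdeg hconn (-g) x (by simpa using h)
      (exists_nonpos_of_sum_eq_zero (-g) (by simp [hg]))
    rw [edgeEnergy_neg] at this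
    simpa [abs_of_neg h] using this
  · have : 0 ≤ ∑ y, |g y| := sum_nonneg fun y _ => abs_nonneg _
    have := edgeEnergy_nonneg E g
    rw [h, abs_zero, zero_pow three_ne_zero, mul_zero]
    positivity
  · rw [abs_of_pos h]
    exact nash_of_pos E hd hdeg hconn g x h (exists_nonpos_of_sum_eq_zero g hg)

/-- Nash-type inequality for mean-zero functions of `ℓ¹` norm at most `2`. -/
lemma nash_sum_sq {d : ℕ} (hd : 0 < d) (hdeg : ∀ x, dout E x = d)
    (hconn : (SimpleGraph.fromRel E).Connected) (g : V → ℝ) (hg : ∑ x, g x = 0)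
    (hg1 : ∑ x, |g x| ≤ 2) :
    d * (∑ x, g x ^ 2) ^ 3 ≤ 3072 * edgeEnergy E g := by
  have := hconn.nonempty
  obtain ⟨x, -, hx⟩ := exists_max_image univ (fun x => |g x|) univ_nonempty
  have hφ : ∑ y, g y ^ 2 ≤ 2 * |g x| := by
    calc ∑ y, g y ^ 2 ≤ ∑ y, |g x| * |g y| := by
          refine sum_le_sum fun y hy => ?_
          rw [← sq_abs, sq]
          exact mul_le_mul_of_nonneg_right (hx y hy) (abs_nonneg _)
      _ = |g x| * ∑ y, |g y| := by rw [mul_sum]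
      _ ≤ 2 * |g x| := by nlinarith [abs_nonneg (g x)]
  have h1 : (∑ y, g y ^ 2) ^ 3 ≤ (2 * |g x|) ^ 3 :=
    pow_le_pow_left₀ (sum_nonneg fun y _ => sq_nonneg _) hφ 3
  have h2 := nash_abs E hd hdeg hconn g hg x
  have h3 := mul_le_mul_of_nonneg_left h1 (Nat.cast_nonneg d : (0 : ℝ) ≤ d)
  have h4 := mul_le_mul_of_nonneg_right hg1 (edgeEnergy_nonneg E g)
  nlinarith

end Nash

section LazyWalk

variable {V : Type} [Fintype V] [DecidableEq V] (E : V → V → Prop) [DecidableRel E]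

lemma lazyP_nonneg (x y : V) : 0 ≤ lazyP E x y := by
  unfold lazyP; split_ifs <;> positivity

lemma lazyP_eq {d : ℕ} (hE : ∀ x, ¬ E x x) (hdeg : ∀ x, dout E x = d) (x y : V) :
    lazyP E x y = (if x = y then 1 / 2 else 0) + if E x y then 1 / (2 * (d : ℝ)) else 0 := by
  unfold lazyP
  rw [hdeg]
  by_cases h : x = y
  · subst h; simp [hE]
  · simp [h]

lemma sum_lazyP_row {d : ℕ} (hd : 0 < d) (hE : ∀ x, ¬ E x x) (hdeg : ∀ x, dout E x = d) (x : V) :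
    ∑ y, lazyP E x y = 1 := by
  have : (d : ℝ) ≠ 0 := by exact_mod_cast hd.ne'
  simp only [lazyP_eq E hE hdeg, sum_add_distrib, sum_out_const, hdeg, sum_ite_eq, mem_univ,
    if_true]
  field_simp; norm_num

lemma sum_lazyP_col {d : ℕ} (hd : 0 < d) (hE : ∀ x, ¬ E x x) (hdeg : ∀ x, dout E x = d)
    (hin : ∀ x, din E x = d) (y : V) : ∑ x, lazyP E x y = 1 := by
  have : (d : ℝ) ≠ 0 := by exact_mod_cast hd.ne'
  simp only [lazyP_eq E hE hdeg, sum_add_distrib, sum_in_const, hin, sum_ite_eq', mem_univ,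
    if_true]
  field_simp; norm_num

lemma lazyP_mem_doublyStochastic {d : ℕ} (hd : 0 < d) (hE : ∀ x, ¬ E x x)
    (hdeg : ∀ x, dout E x = d) (hin : ∀ x, din E x = d) : lazyP E ∈ doublyStochastic ℝ V :=
  mem_doublyStochastic_iff_sum.2
    ⟨lazyP_nonneg E, sum_lazyP_row E hd hE hdeg, sum_lazyP_col E hd hE hdeg hin⟩

lemma lazyP_swap {d : ℕ} (hE : ∀ x, ¬ E x x) (hdeg : ∀ x, dout E x = d)
    (hin : ∀ x, din E x = d) : lazyP (fun x y => E y x) = (lazyP E).transpose := by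
  ext x y
  rw [Matrix.transpose_apply, lazyP_eq E hE hdeg,
    lazyP_eq (fun x y => E y x) hE (d := d) hin]
  simp only [eq_comm]

/-- Variance of `f` after one lazy step bounds the increments along outgoing edges. -/
lemma lazy_variance_lower_bound {d : ℕ} (hd : 0 < d) (hE : ∀ x, ¬ E x x)
    (hdeg : ∀ x, dout E x = d) (f : V → ℝ) (x : V) :
    (∑ y, if E x y then (f x - f y) ^ 2 else 0) / (4 * d) ≤
      ∑ y, lazyP E x y * f y ^ 2 - (∑ y, lazyP E x y * f y) ^ 2 := by
  have hd' : (0 : ℝ) < d := by exact_mod_cast hd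
  set μ := ∑ y, lazyP E x y * f y with hμ
  have hvar : ∑ y, lazyP E x y * (f y - μ) ^ 2 = ∑ y, lazyP E x y * f y ^ 2 - μ ^ 2 := by
    have : ∀ y, lazyP E x y * (f y - μ) ^ 2 = lazyP E x y * f y ^ 2
        - 2 * μ * (lazyP E x y * f y) + μ ^ 2 * lazyP E x y := fun y => by ring
    simp only [this, sum_add_distrib, sum_sub_distrib, ← mul_sum, ← hμ,
      sum_lazyP_row E hd hE hdeg]
    ring
  have hsplit : ∑ y, lazyP E x y * (f y - μ) ^ 2 =
      ∑ y, if E x y then ((f x - μ) ^ 2 + (f y - μ) ^ 2) / (2 * d) else 0 := by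
    have h1 : ∑ y, (if E x y then ((f x - μ) ^ 2 + (f y - μ) ^ 2) / (2 * (d : ℝ)) else 0) =
        (∑ y, if E x y then (f x - μ) ^ 2 / (2 * d) else 0) +
          ∑ y, if E x y then (f y - μ) ^ 2 / (2 * d) else 0 := by
      rw [← sum_add_distrib]
      refine sum_congr rfl fun y _ => ?_
      split_ifs <;> ring
    rw [h1, sum_out_const, hdeg]
    simp only [lazyP_eq E hE hdeg, add_mul, sum_add_distrib, ite_mul, zero_mul, sum_ite_eq,
      mem_univ, if_true]
    congr 1
    · field_simp
    · refine sum_congr rfl fun y _ => ?_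
      split_ifs <;> ring
  rw [← hvar, hsplit, sum_div]
  refine sum_le_sum fun y _ => ?_
  split_ifs
  · rw [div_le_div_iff₀ (by positivity) (by positivity)]
    nlinarith [mul_nonneg hd'.le (sq_nonneg ((f x - μ) + (f y - μ)))]
  · simp

/-- One step of the lazy walk dissipates `ℓ²` mass at the rate of the edge energy. -/
lemma sum_sq_mulVec_lazyP_le {d : ℕ} (hd : 0 < d) (hE : ∀ x, ¬ E x x)
    (hdeg : ∀ x, dout E x = d) (hin : ∀ x, din E x = d) (f : V → ℝ) :
    ∑ x, (∑ y, lazyP E x y * f y) ^ 2 ≤ ∑ x, f x ^ 2 - edgeEnergy E f / (4 * d) := by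
  have h := sum_le_sum fun x (_ : x ∈ univ) => lazy_variance_lower_bound E hd hE hdeg f x
  rw [sum_sub_distrib, ← sum_div,
    sum_comm (f := fun x y => lazyP E x y * f y ^ 2)] at h
  simp only [← sum_mul, sum_lazyP_col E hd hE hdeg hin, one_mul] at h
  unfold edgeEnergy
  linarith

end LazyWalk

/-- A nonnegative sequence with `u (t + 1) ≤ u t - c * u t ^ 3` decays like `1 / √(c t)`. -/
lemma mul_sq_le_one_of_cubic_decay {c : ℝ} (hc : 0 < c) (u : ℕ → ℝ) (hu : ∀ t, 0 ≤ u t)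
    (h : ∀ t, u (t + 1) ≤ u t - c * u t ^ 3) (t : ℕ) : c * t * u t ^ 2 ≤ 1 := by
  induction t with
  | zero => simp
  | succ t ih =>
    rcases (hu t).eq_or_lt with h0 | h0
    · have h1 := h t
      rw [← h0] at h1
      have : u (t + 1) = 0 := le_antisymm (by simpa using h1) (hu _)
      simp [this]
    · set z := c * u t ^ 2 with hz
      have hz0 : 0 ≤ z := by positivity
      have hz1 : z ≤ 1 := by
        have h1 := (hu (t + 1)).trans (h t)
        by_contra hcon
        push Not at hcon
        nlinarith [mul_lt_mul_of_pos_left hcon h0]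
      have hsq : u (t + 1) ^ 2 ≤ (u t * (1 - z)) ^ 2 :=
        pow_le_pow_left₀ (hu _) ((h t).trans (by rw [hz]; nlinarith)) 2
      have htz : t * z ≤ 1 := by rw [hz]; linarith
      calc c * ((t + 1 : ℕ) : ℝ) * u (t + 1) ^ 2
          ≤ c * ((t + 1 : ℕ) : ℝ) * (u t * (1 - z)) ^ 2 := by gcongr
        _ = (t * z + z) * (1 - z) ^ 2 := by rw [hz]; push_cast; ring
        _ ≤ (1 + z) * (1 - z) ^ 2 := by gcongr
        _ = 1 - z * (1 + z * (1 - z)) := by ring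
        _ ≤ 1 := by
          have : 0 ≤ z * (1 + z * (1 - z)) :=
            mul_nonneg hz0 (by nlinarith [mul_nonneg hz0 (sub_nonneg.2 hz1)])
          linarith

section Mixing

variable {V : Type} [Fintype V] [DecidableEq V] (E : V → V → Prop) [DecidableRel E]

/-- `ℓ²` decay of the columns of the powers of the lazy transition matrix. -/
lemma sum_sq_lazyP_pow_col {d : ℕ} (hd : 0 < d) (hE : ∀ x, ¬ E x x)
    (hdeg : ∀ x, dout E x = d) (hin : ∀ x, din E x = d)
    (hconn : (SimpleGraph.fromRel E).Connected) (t : ℕ) (y : V) :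
    1 / 12288 * (t : ℝ) * (∑ z, ((lazyP E ^ t) z y - 1 / Fintype.card V) ^ 2) ^ 2 ≤ 1 := by
  have := hconn.nonempty
  have hd' : (0 : ℝ) < d := by exact_mod_cast hd
  have hn : (Fintype.card V : ℝ) ≠ 0 := by exact_mod_cast Fintype.card_ne_zero
  have hmem := fun t => mem_doublyStochastic_iff_sum.1
    (pow_mem (lazyP_mem_doublyStochastic E hd hE hdeg hin) t)
  refine mul_sq_le_one_of_cubic_decay (by norm_num)
    (fun t => ∑ z, ((lazyP E ^ t) z y - 1 / Fintype.card V) ^ 2)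
    (fun t => sum_nonneg fun z _ => sq_nonneg _) (fun t => ?_) t
  set g : V → ℝ := fun z => (lazyP E ^ t) z y - 1 / Fintype.card V with hg
  have hsum : ∑ z, g z = 0 := by
    simp only [hg, sum_sub_distrib, (hmem t).2.2 y, sum_const, card_univ, nsmul_eq_mul]
    field_simp; norm_num
  have habs : ∑ z, |g z| ≤ 2 := by
    calc ∑ z, |g z| ≤ ∑ z, ((lazyP E ^ t) z y + 1 / Fintype.card V) := by
          refine sum_le_sum fun z _ => (abs_sub _ _).trans ?_
          rw [abs_of_nonneg ((hmem t).1 z y), abs_of_nonneg (by positivity)]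
      _ = 2 := by
          simp only [sum_add_distrib, (hmem t).2.2 y, sum_const, card_univ, nsmul_eq_mul]
          field_simp; norm_num
  have hstep : ∀ z, (lazyP E ^ (t + 1)) z y - 1 / Fintype.card V = ∑ w, lazyP E z w * g w := by
    intro z
    rw [pow_succ', Matrix.mul_apply]
    simp only [hg, mul_sub, sum_sub_distrib, ← sum_mul, sum_lazyP_row E hd hE hdeg, one_mul]
  simp only [hstep]
  have h1 := sum_sq_mulVec_lazyP_le E hd hE hdeg hin g
  have h2 := nash_sum_sq E hd hdeg hconn g hsum habs
  have h3 : 1 / 12288 * (∑ z, g z ^ 2) ^ 3 ≤ edgeEnergy E g / (4 * d) := by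
    rw [le_div_iff₀ (by positivity)]
    linarith
  linarith

/-- Uniform decay of the powers of the lazy transition matrix towards `1 / n`. -/
lemma abs_lazyP_pow_sub_le {d : ℕ} (hd : 0 < d) (hE : ∀ x, ¬ E x x)
    (hdeg : ∀ x, dout E x = d) (hin : ∀ x, din E x = d)
    (hconn : (SimpleGraph.fromRel E).Connected) (t : ℕ) (x y : V) :
    t * ((lazyP E ^ (t + t)) x y - 1 / Fintype.card V) ^ 2 ≤ 12288 := by
  have := hconn.nonempty
  have hn : (Fintype.card V : ℝ) ≠ 0 := by exact_mod_cast Fintype.card_ne_zero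
  have hmem := mem_doublyStochastic_iff_sum.1
    (pow_mem (lazyP_mem_doublyStochastic E hd hE hdeg hin) t)
  have hcol := sum_sq_lazyP_pow_col E hd hE hdeg hin hconn t y
  have hrow := sum_sq_lazyP_pow_col (fun x y => E y x) hd hE hin hdeg
    (by convert hconn using 1; ext u v; simp [SimpleGraph.fromRel_adj, or_comm]) t x
  simp only [lazyP_swap E hE hdeg hin, ← Matrix.transpose_pow, Matrix.transpose_apply] at hrow
  set A := ∑ z, ((lazyP E ^ t) x z - 1 / Fintype.card V) ^ 2
  set B := ∑ z, ((lazyP E ^ t) z y - 1 / Fintype.card V) ^ 2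
  have hprod : (lazyP E ^ (t + t)) x y - 1 / Fintype.card V =
      ∑ z, ((lazyP E ^ t) x z - 1 / Fintype.card V) * ((lazyP E ^ t) z y - 1 / Fintype.card V) := by
    rw [pow_add, Matrix.mul_apply]
    simp only [sub_mul, mul_sub, sum_sub_distrib, ← sum_mul, ← mul_sum, hmem.2.1 x, hmem.2.2 y,
      sum_const, card_univ, nsmul_eq_mul]
    field_simp; ring
  have hcs : ((lazyP E ^ (t + t)) x y - 1 / Fintype.card V) ^ 2 ≤ A * B := by
    rw [hprod]; exact sum_mul_sq_le_sq_mul_sq _ _ _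
  have hAB : A * B ≤ (A ^ 2 + B ^ 2) / 2 := by nlinarith [sq_nonneg (A - B)]
  have := mul_le_mul_of_nonneg_left (hcs.trans hAB) (Nat.cast_nonneg t : (0 : ℝ) ≤ t)
  linarith

end Mixing

lemma statDist_of_regular {V : Type} [Fintype V] (E : V → V → Prop) [DecidableRel E]
    {d : ℕ} (hd : 0 < d) (hdeg : ∀ x, dout E x = d) (y : V) :
    statDist E y = 1 / Fintype.card V := by
  have hd' : (d : ℝ) ≠ 0 := by exact_mod_cast hd.ne'
  have : Nonempty V := ⟨y⟩
  have hn : (Fintype.card V : ℝ) ≠ 0 := by exact_mod_cast Fintype.card_ne_zero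
  simp only [statDist, numEdges, hdeg, sum_const, card_univ, smul_eq_mul, Nat.cast_mul]
  field_simp

/-- There is a positive constant `c3` such that for every connected `d`-regular
Eulerian digraph on `n` vertices and every `a > 0`, the lazy simple random walk satisfies
`t_unif(a) ≤ c3·n²/a²`, i.e. there is a time `t` below this bound at which
`|P^t(x,y)/π(y) − 1| ≤ a` for all vertices `x, y`. -/
theorem regular_eulerian_lazy_tunif_a_bound :
    ∃ c3 : ℝ, 0 < c3 ∧
      ∀ (V : Type) [Fintype V] [DecidableEq V] (E : V → V → Prop) [DecidableRel E] (d : ℕ),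
        (∀ x, ¬ E x x) →
        0 < d →
        (∀ x, dout E x = d ∧ din E x = d) →
        (SimpleGraph.fromRel E).Connected →
        ∀ a : ℝ, 0 < a →
          ∃ t : ℕ,
            (t : ℝ) ≤ c3 * (Fintype.card V : ℝ) ^ 2 / a ^ 2 ∧
            ∀ x y : V, |(lazyP E ^ t) x y / statDist E y - 1| ≤ a := by
  refine ⟨49152, by norm_num, ?_⟩
  intro V _ _ E _ d hE hd hreg hconn a ha
  have hdeg := fun x => (hreg x).1
  have hin := fun x => (hreg x).2
  have := hconn.nonempty
  have hn : (1 : ℝ) ≤ Fintype.card V := by exact_mod_cast Fintype.card_pos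
  have hpi := statDist_of_regular E hd hdeg
  set n : ℝ := (Fintype.card V : ℝ) with hn_def
  have hratio : ∀ (t : ℕ) (x y : V),
      (lazyP E ^ t) x y / statDist E y - 1 = n * ((lazyP E ^ t) x y - 1 / n) := by
    intro t x y
    rw [hpi]
    field_simp
  rcases le_or_gt (12288 * n ^ 2 / a ^ 2) 1 with hsmall | hlarge
  · refine ⟨0, by simp only [Nat.cast_zero]; positivity, fun x y => ?_⟩
    rw [div_le_one (by positivity)] at hsmall
    have hna : n ≤ a := (sq_le_sq₀ (by linarith) ha.le).1 (by nlinarith)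
    refine le_trans ?_ hna
    rw [hpi, pow_zero, Matrix.one_apply]
    split_ifs
    · rw [one_div_one_div, abs_of_nonneg] <;> linarith
    · simpa using hn
  · set T := ⌈12288 * n ^ 2 / a ^ 2⌉₊
    have hT1 : 12288 * n ^ 2 / a ^ 2 ≤ T := Nat.le_ceil _
    have hT2 : (T : ℝ) < 12288 * n ^ 2 / a ^ 2 + 1 := Nat.ceil_lt_add_one (by positivity)
    refine ⟨T + T, ?_, fun x y => ?_⟩
    · have : 49152 * n ^ 2 / a ^ 2 = 4 * (12288 * n ^ 2 / a ^ 2) := by ring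
      rw [this]; push_cast; linarith
    · rw [hratio]
      refine abs_le_of_sq_le_sq ?_ ha.le
      have h1 := abs_lazyP_pow_sub_le E hd hE hdeg hin hconn T x y
      rw [← hn_def] at h1
      set q := ((lazyP E ^ (T + T)) x y - 1 / n)
      rw [div_le_iff₀ (by positivity)] at hT1
      have h2 : 12288 * (n * q) ^ 2 ≤ 12288 * a ^ 2 := by
        calc 12288 * (n * q) ^ 2 = 12288 * n ^ 2 * q ^ 2 := by ring
          _ ≤ T * a ^ 2 * q ^ 2 := by gcongr
          _ = T * q ^ 2 * a ^ 2 := by ring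
          _ ≤ 12288 * a ^ 2 := by gcongr
      linarith
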